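/- Let s be an integer, l ≥ |s|, and define the spin-s zonal harmonic ₛZ_l(θ,φ) = (−1)^{max(s,0)} √((2l+1)/(4π)) · ₛY_{l,−s}(θ,φ). Then for every (θ₀,φ₀) ∈ (0,π)×ℝ and every fixed φ ∈ ℝ, ₛZ_l(θ₀,φ₀) = lim_{θ→0⁺} e^{−isφ} Σ_{m=−l}^{l} ₛY_{lm}(θ₀,φ₀) · conj(ₛY_{lm}(θ,φ)). -/

import Mathlib

noncomputable section

/-- Integer binomial coefficient, zero outside `0 ≤ j ≤ n`. -/
def izbinom (n j : ℤ) : ℕ := if 0 ≤ j ∧ j ≤ n then n.toNat.choose j.toNat else 0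

/-- The normalization constant `a_{lm} = √((l+m)!(l−m)!(2l+1)/(4π))`. -/
noncomputable def alm (l m : ℤ) : ℝ :=
  Real.sqrt ((((l + m).toNat.factorial : ℝ) * ((l - m).toNat.factorial : ℝ) * (2 * (l : ℝ) + 1)) /
    (4 * Real.pi))

/-- The spin-`s` spherical harmonic `ₛY_{lm}` in the standard chart, as a function of `(θ, φ)`. -/
noncomputable def sY (s l m : ℤ) (x : ℝ × ℝ) : ℂ :=
  Complex.exp (Complex.I * (m : ℂ) * (x.2 : ℂ)) * (-1 : ℂ) ^ (max (-m) 0) *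
    ((alm l m / Real.sqrt (((l + s).toNat.factorial : ℝ) * ((l - s).toNat.factorial : ℝ)) : ℝ) : ℂ) *
    ((Real.sin (x.1 / 2) : ℂ)) ^ (2 * l) *
    ∑ r ∈ Finset.Icc (0 : ℤ) (l - s),
      (izbinom (l - s) r : ℂ) * (izbinom (l + s) (r + s - m) : ℂ) * (-1 : ℂ) ^ (l - r - s) *
        ((Real.cos (x.1 / 2) / Real.sin (x.1 / 2) : ℝ) : ℂ) ^ (2 * r + s - m)

/-- The spin-`s` zonal harmonic `ₛZ_l`. -/
noncomputable def sZ (s l : ℤ) (x : ℝ × ℝ) : ℂ :=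
  (-1 : ℂ) ^ (max s 0) * (Real.sqrt ((2 * (l : ℝ) + 1) / (4 * Real.pi)) : ℂ) * sY s l (-s) x

open Filter Topology in
/-- Near the north pole, `sin(θ/2)^k cot(θ/2)^n` tends to `0 ^ (k - n)` when `n ≤ k`. -/
lemma tendsto_sin_zpow_mul_cot_zpow (k n : ℤ) (hn : n ≤ k) :
    Tendsto (fun θ : ℝ => ((Real.sin (θ / 2) : ℝ) : ℂ) ^ k *
        ((Real.cos (θ / 2) / Real.sin (θ / 2) : ℝ) : ℂ) ^ n)
      (𝓝[>] 0) (𝓝 ((0 : ℂ) ^ (k - n))) := by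
  have hs : Tendsto (fun θ : ℝ => ((Real.sin (θ / 2) : ℝ) : ℂ)) (𝓝[>] 0) (𝓝 0) := by
    have h : Continuous (fun θ : ℝ => ((Real.sin (θ / 2) : ℝ) : ℂ)) := by fun_prop
    simpa using (h.tendsto 0).mono_left nhdsWithin_le_nhds
  have hc : Tendsto (fun θ : ℝ => ((Real.cos (θ / 2) : ℝ) : ℂ)) (𝓝[>] 0) (𝓝 1) := by
    have h : Continuous (fun θ : ℝ => ((Real.cos (θ / 2) : ℝ) : ℂ)) := by fun_prop
    simpa using (h.tendsto 0).mono_left nhdsWithin_le_nhds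
  have h := (hs.zpow₀ (k - n) (Or.inr (by lia))).mul (hc.zpow₀ n (Or.inl one_ne_zero))
  rw [one_zpow, mul_one] at h
  refine h.congr' ?_
  filter_upwards [Ioo_mem_nhdsGT Real.pi_pos] with θ hθ
  have h0 : ((Real.sin (θ / 2) : ℝ) : ℂ) ≠ 0 :=
    Complex.ofReal_ne_zero.2
      (Real.sin_pos_of_pos_of_lt_pi (by linarith [hθ.1]) (by linarith [hθ.1, hθ.2])).ne'
  rw [Complex.ofReal_div, div_zpow, zpow_sub₀ h0]
  ring

lemma izbinom_self {n : ℤ} (hn : 0 ≤ n) : izbinom n n = 1 := by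
  simp [izbinom, hn]

open Filter Topology in
/-- Only the top summand of the `m = -s` harmonic survives at the north pole. -/
lemma tendsto_sY_summand {s l : ℤ} (hl : |s| ≤ l) (m r : ℤ) :
    Tendsto (fun θ : ℝ => ((Real.sin (θ / 2) : ℝ) : ℂ) ^ (2 * l) *
        ((izbinom (l - s) r : ℂ) * (izbinom (l + s) (r + s - m) : ℂ) * (-1 : ℂ) ^ (l - r - s) *
          ((Real.cos (θ / 2) / Real.sin (θ / 2) : ℝ) : ℂ) ^ (2 * r + s - m)))
      (𝓝[>] 0) (𝓝 (if r = l - s ∧ m = -s then 1 else 0)) := by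
  obtain ⟨h1, h2⟩ := abs_le.1 hl
  by_cases hr : r ≤ l - s ∧ r + s - m ≤ l + s
  · have h := (tendsto_sin_zpow_mul_cot_zpow (2 * l) (2 * r + s - m) (by lia)).const_mul
      ((izbinom (l - s) r : ℂ) * (izbinom (l + s) (r + s - m) : ℂ) * (-1 : ℂ) ^ (l - r - s))
    convert h using 2
    · ring
    · split_ifs with hc
      · obtain ⟨rfl, rfl⟩ := hc
        rw [show l - s + s - -s = l + s by ring, izbinom_self (by lia), izbinom_self (by lia),
          show l - (l - s) - s = 0 by ring, show 2 * l - (2 * (l - s) + s - -s) = 0 by ring]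
        simp
      · rw [zero_zpow _ (by lia), mul_zero]
  · have h0 : (izbinom (l - s) r : ℂ) * (izbinom (l + s) (r + s - m) : ℂ) = 0 := by
      rcases not_and_or.1 hr with h | h <;> simp [izbinom, h]
    rw [if_neg (by lia)]
    simp [h0]

lemma alm_neg_div (s l : ℤ) :
    alm l (-s) / √(((l + s).toNat.factorial : ℝ) * ((l - s).toNat.factorial : ℝ)) =
      √((2 * (l : ℝ) + 1) / (4 * Real.pi)) := by
  have hp : (0 : ℝ) < ((l + s).toNat.factorial : ℝ) * ((l - s).toNat.factorial : ℝ) := by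
    positivity
  rw [alm, ← Real.sqrt_div' _ hp.le, ← sub_eq_add_neg, sub_neg_eq_add]
  congr 1
  field_simp

open Filter Topology in
/-- The limit of `ₛY_{lm}` at the north pole along a meridian. -/
lemma tendsto_sY_north_pole {s l : ℤ} (hl : |s| ≤ l) (m : ℤ) (φ : ℝ) :
    Tendsto (fun θ : ℝ => sY s l m (θ, φ)) (𝓝[>] 0)
      (𝓝 (if m = -s then Complex.exp (-(Complex.I * (s : ℂ) * (φ : ℂ))) * (-1 : ℂ) ^ (max s 0) *
        (√((2 * (l : ℝ) + 1) / (4 * Real.pi)) : ℂ) else 0)) := by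
  obtain ⟨h1, h2⟩ := abs_le.1 hl
  have h := (tendsto_finsetSum (Finset.Icc (0 : ℤ) (l - s))
    (fun r _ => tendsto_sY_summand hl m r)).const_mul
      (Complex.exp (Complex.I * (m : ℂ) * (φ : ℂ)) * (-1 : ℂ) ^ (max (-m) 0) *
        ((alm l m / √(((l + s).toNat.factorial : ℝ) * ((l - s).toNat.factorial : ℝ)) : ℝ) : ℂ))
  convert h using 2
  · rw [sY, ← Finset.mul_sum, ← mul_assoc]
  · split_ifs with hm
    · subst hm
      rw [alm_neg_div]
      simp [Finset.sum_ite_eq', show s ≤ l from h2]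
    · simp [hm]

/-- **The spin zonal harmonic as a limit of the reproducing kernel at the north pole**
(Statement 8). -/
theorem sZ_eq_limit_kernel (s l : ℤ) (hl : |s| ≤ l) (x₀ : ℝ × ℝ)
    (hx₀ : x₀.1 ∈ Set.Ioo 0 Real.pi) (φ : ℝ) :
    Filter.Tendsto
      (fun θ : ℝ => Complex.exp (-(Complex.I * (s : ℂ) * (φ : ℂ))) *
        ∑ m ∈ Finset.Icc (-l) l, sY s l m x₀ * (starRingEnd ℂ) (sY s l m (θ, φ)))
      (nhdsWithin 0 (Set.Ioi 0)) (nhds (sZ s l x₀)) := by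
  obtain ⟨h1, h2⟩ := abs_le.1 hl
  have h := (tendsto_finsetSum (Finset.Icc (-l) l) (fun m _ =>
    ((Complex.continuous_conj.tendsto _).comp (tendsto_sY_north_pole hl m φ)).const_mul
      (sY s l m x₀))).const_mul (Complex.exp (-(Complex.I * (s : ℂ) * (φ : ℂ))))
  refine (congrArg (Filter.Tendsto _ _ <| nhds ·) ?_).mp h
  have hs : -s ∈ Finset.Icc (-l) l := Finset.mem_Icc.2 ⟨by lia, by lia⟩
  rw [Finset.sum_eq_single_of_mem (-s) hs (fun m _ hm => by simp [hm]), if_pos rfl, sZ]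
  simp only [map_mul, map_zpow₀, map_neg, map_one, Complex.conj_ofReal, ← Complex.exp_conj,
    Complex.conj_I, map_intCast]
  have he : Complex.exp (-(Complex.I * (s : ℂ) * (φ : ℂ))) *
      Complex.exp (-(-Complex.I * (s : ℂ) * (φ : ℂ))) = 1 := by
    rw [← Complex.exp_add, ← Complex.exp_zero]
    congr 1
    ring
  linear_combination (sY s l (-s) x₀ * (-1 : ℂ) ^ (max s 0) *
    (√((2 * (l : ℝ) + 1) / (4 * Real.pi)) : ℂ)) * he
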